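/- For every integer k ≥ 0, Σ_{n=1}^∞ H*_k(n+1)/(n(n+1)) = k + 1. -/

import Mathlib

/-- The iterated harmonic sums: `H*_0(n) = 1` and `H*_k(n) = Σ_{m=1}^n H*_{k-1}(m)/m`. -/
noncomputable def iterHarmonic : ℕ → ℕ → ℝ
  | 0, _ => 1
  | k + 1, n => ∑ m ∈ Finset.Icc 1 n, iterHarmonic k m / m

open Filter Topology

theorem iterHarmonic_succ_eq_sum_range (k n : ℕ) :
    iterHarmonic (k + 1) n =
      ∑ i ∈ Finset.range n, iterHarmonic k (i + 1) / ((i + 1 : ℕ) : ℝ) := by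
  rw [iterHarmonic, Finset.range_eq_Ico,
    Finset.sum_Ico_add' (fun m : ℕ => iterHarmonic k m / (m : ℝ)) 0 n 1]
  rfl

theorem iterHarmonic_succ_succ (k n : ℕ) :
    iterHarmonic (k + 1) (n + 1) =
      iterHarmonic (k + 1) n + iterHarmonic k (n + 1) / ((n : ℝ) + 1) := by
  simp [iterHarmonic_succ_eq_sum_range, Finset.sum_range_succ]

theorem iterHarmonic_nonneg (k n : ℕ) : 0 ≤ iterHarmonic k n := by
  induction k generalizing n with
  | zero => simp [iterHarmonic]
  | succ k ih =>
    rw [iterHarmonic]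
    exact Finset.sum_nonneg fun m _ => div_nonneg (ih m) m.cast_nonneg

theorem iterHarmonic_one (k : ℕ) : iterHarmonic k 1 = 1 := by
  induction k with
  | zero => simp [iterHarmonic]
  | succ k ih => simp [iterHarmonic, ih]

theorem tendsto_iterHarmonic_div_atTop (k : ℕ) :
    Tendsto (fun n : ℕ => iterHarmonic k n / (n : ℝ)) atTop (𝓝 0) := by
  induction k with
  | zero => simpa [iterHarmonic] using tendsto_inv_atTop_nhds_zero_nat (𝕜 := ℝ)
  | succ k ih =>
    refine ((ih.comp (tendsto_add_atTop_nat 1)).cesaro).congr fun n => ?_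
    rw [iterHarmonic_succ_eq_sum_range, div_eq_inv_mul]
    rfl

theorem hasSum_iterHarmonic_div (k : ℕ) :
    HasSum (fun n : ℕ => iterHarmonic k (n + 2) / (((n : ℝ) + 1) * ((n : ℝ) + 2)))
      ((k : ℝ) + 1) := by
  have telescope (u : ℕ → ℝ) (hu : Tendsto (fun n : ℕ => u n / (n : ℝ)) atTop (𝓝 0)) :
      Tendsto (fun N => ∑ n ∈ Finset.range N, (u (n + 1) / ((n + 1 : ℕ) : ℝ) -
        u (n + 1 + 1) / ((n + 1 + 1 : ℕ) : ℝ))) atTop (𝓝 (u 1)) := by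
    simp_rw [Finset.sum_range_sub' (fun n => u (n + 1) / ((n + 1 : ℕ) : ℝ))]
    simpa using (hu.comp (tendsto_add_atTop_nat 1)).const_sub (u 1)
  have nonneg (j n : ℕ) : 0 ≤ iterHarmonic j (n + 2) / (((n : ℝ) + 1) * ((n : ℝ) + 2)) :=
    div_nonneg (iterHarmonic_nonneg _ _) (by positivity)
  induction k with
  | zero =>
    rw [hasSum_iff_tendsto_nat_of_nonneg (nonneg 0)]
    have h := telescope _ (tendsto_iterHarmonic_div_atTop 0)
    rw [iterHarmonic_one] at h
    simp only [Nat.cast_zero, zero_add]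
    refine h.congr fun N => Finset.sum_congr rfl fun n _ => ?_
    simp only [iterHarmonic]
    push_cast
    field_simp
    ring
  | succ k ih =>
    rw [hasSum_iff_tendsto_nat_of_nonneg (nonneg k)] at ih
    rw [hasSum_iff_tendsto_nat_of_nonneg (nonneg (k + 1))]
    have h := ih.add (telescope _ (tendsto_iterHarmonic_div_atTop (k + 1)))
    rw [iterHarmonic_one] at h
    push_cast
    refine h.congr fun N => ?_
    rw [← Finset.sum_add_distrib]
    refine Finset.sum_congr rfl fun n _ => ?_
    rw [iterHarmonic_succ_succ k (n + 1)]
    push_cast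
    field_simp
    ring

theorem stmt16 (k : ℕ) :
    ∑' n : ℕ, iterHarmonic k (n + 2) / (((n : ℝ) + 1) * ((n : ℝ) + 2)) = k + 1 :=
  (hasSum_iterHarmonic_div k).tsum_eq
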